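/- arXiv:1402.4173 — 2 statements merged into one kernel-verified Lean document; each statement's English description precedes it below -/
import Mathlib

section
/- (Fractional Hardy inequality on a cone) Let Σ = ∂E_α be a Lawson cone in ℝ^N, 0 < s < 1, β = (N−2−s)/2, and let H(m,n,s) = p.v.∫_Σ (1 − |y|^{−β})/|p̂ − y|^{N+s} dy for any p̂ ∈ Σ with |p̂| = 1. Then for every φ ∈ C₀^∞(Σ∖{0}), H(m,n,s)·∫_Σ φ(x)²/|x|^{1+s} dx ≤ (1/2)∫_Σ∫_Σ (φ(x)−φ(y))²/|x−y|^{N+s} dx dy. -/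
open MeasureTheory Filter
open scoped Topology

theorem setLIntegral_rpow_neg_dist_ball_le {E : Type*} [PseudoMetricSpace E] [MeasurableSpace E]
    [OpensMeasurableSpace E] {μ : Measure E} {C : NNReal} {d γ : ℝ}
    (hμ : ∀ x : E, ∀ r : ℝ, 0 < r → μ (Metric.closedBall x r) ≤ C * ENNReal.ofReal (r ^ d))
    (hγ : 0 < γ) (hγd : γ < d) :
    ∃ K : NNReal, ∀ x : E, ∫⁻ y in {y | dist x y ≤ 1}, ENNReal.ofReal (dist x y ^ (-γ)) ∂μ ≤ K := by
  have hsum : Summable fun k : ℕ => (2 : ℝ) ^ γ * ((1 / 2 : ℝ) ^ (d - γ)) ^ k :=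
    (summable_geometric_of_lt_one (by positivity)
      (Real.rpow_lt_one (by norm_num) (by norm_num) (by linarith))).mul_left _
  refine ⟨C * (∑' k : ℕ, ENNReal.ofReal ((2 : ℝ) ^ γ * ((1 / 2 : ℝ) ^ (d - γ)) ^ k)).toNNReal,
    fun x => ?_⟩
  have hmeas : MeasurableSet {y | dist x y ≤ 1} :=
    (isClosed_le (by fun_prop) continuous_const).measurableSet
  rw [ENNReal.coe_mul, ENNReal.coe_toNNReal hsum.tsum_ofReal_ne_top, ← ENNReal.tsum_mul_left,
    ← lintegral_indicator hmeas]
  calc _ ≤ ∫⁻ y, ∑' k : ℕ, (Metric.closedBall x ((1 / 2 : ℝ) ^ k)).indicator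
          (fun _ => ENNReal.ofReal (((1 / 2 : ℝ) ^ (k + 1)) ^ (-γ))) y ∂μ := by
        refine lintegral_mono fun y => ?_
        by_cases hy : y ∈ {y | dist x y ≤ 1}
        swap
        · rw [Set.indicator_of_notMem hy]; exact zero_le
        rw [Set.indicator_of_mem hy]
        rcases eq_or_lt_of_le (dist_nonneg (x := x) (y := y)) with h0 | h0
        · rw [← h0, Real.zero_rpow (by linarith)]; simp
        obtain ⟨k, hk1, hk2⟩ := exists_nat_pow_near_of_lt_one h0 hy
          (by norm_num : (0 : ℝ) < 1 / 2) (by norm_num)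
        refine le_trans ?_ (ENNReal.le_tsum k)
        rw [Set.indicator_of_mem (by rwa [Metric.mem_closedBall, dist_comm])]
        exact ENNReal.ofReal_le_ofReal
          (Real.rpow_le_rpow_of_nonpos (by positivity) hk1.le (by linarith))
    _ = ∑' k : ℕ, ENNReal.ofReal (((1 / 2 : ℝ) ^ (k + 1)) ^ (-γ))
          * μ (Metric.closedBall x ((1 / 2 : ℝ) ^ k)) := by
        rw [lintegral_tsum fun k => (measurable_const.indicator
          Metric.isClosed_closedBall.measurableSet).aemeasurable]
        simp_rw [lintegral_indicator_const Metric.isClosed_closedBall.measurableSet]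
    _ ≤ _ := by
        refine ENNReal.tsum_le_tsum fun k => ?_
        refine (mul_le_mul_right (hμ x _ (by positivity)) _).trans (le_of_eq ?_)
        rw [mul_left_comm, ← ENNReal.ofReal_mul (by positivity)]
        congr 2
        rw [← Real.rpow_natCast (1 / 2), ← Real.rpow_natCast (1 / 2), ← Real.rpow_natCast (_ ^ _),
          ← Real.rpow_mul (by norm_num), ← Real.rpow_mul (by norm_num),
          ← Real.rpow_mul (by norm_num), ← Real.rpow_add (by norm_num),
          show (2 : ℝ) = (1 / 2) ^ (-1 : ℝ) by norm_num [Real.rpow_neg_one],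
          ← Real.rpow_mul (by norm_num), Real.rpow_neg_one, one_div, inv_inv,
          ← Real.rpow_add (by norm_num)]
        congr 1; push_cast; ring

theorem setLIntegral_rpow_neg_dist_compl_ball_le {E : Type*} [PseudoMetricSpace E]
    [MeasurableSpace E] [OpensMeasurableSpace E] {μ : Measure E} {C : NNReal} {d γ : ℝ}
    (hμ : ∀ x : E, ∀ r : ℝ, 0 < r → μ (Metric.closedBall x r) ≤ C * ENNReal.ofReal (r ^ d))
    (hd : 0 ≤ d) (hγd : d < γ) :
    ∃ K : NNReal, ∀ x : E, ∫⁻ y in {y | 1 ≤ dist x y}, ENNReal.ofReal (dist x y ^ (-γ)) ∂μ ≤ K := by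
  have hsum : Summable fun k : ℕ => (2 : ℝ) ^ d * ((2 : ℝ) ^ (d - γ)) ^ k :=
    (summable_geometric_of_lt_one (by positivity)
      (Real.rpow_lt_one_of_one_lt_of_neg (by norm_num) (by linarith))).mul_left _
  refine ⟨C * (∑' k : ℕ, ENNReal.ofReal ((2 : ℝ) ^ d * ((2 : ℝ) ^ (d - γ)) ^ k)).toNNReal,
    fun x => ?_⟩
  have hmeas : MeasurableSet {y | 1 ≤ dist x y} :=
    (isClosed_le continuous_const (by fun_prop)).measurableSet
  rw [ENNReal.coe_mul, ENNReal.coe_toNNReal hsum.tsum_ofReal_ne_top, ← ENNReal.tsum_mul_left,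
    ← lintegral_indicator hmeas]
  calc _ ≤ ∫⁻ y, ∑' k : ℕ, (Metric.closedBall x ((2 : ℝ) ^ (k + 1))).indicator
          (fun _ => ENNReal.ofReal (((2 : ℝ) ^ k) ^ (-γ))) y ∂μ := by
        refine lintegral_mono fun y => ?_
        by_cases hy : y ∈ {y | 1 ≤ dist x y}
        swap
        · rw [Set.indicator_of_notMem hy]; exact zero_le
        rw [Set.indicator_of_mem hy]
        obtain ⟨k, hk1, hk2⟩ := exists_nat_pow_near hy (by norm_num : (1 : ℝ) < 2)
        refine le_trans ?_ (ENNReal.le_tsum k)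
        rw [Set.indicator_of_mem (by rw [Metric.mem_closedBall, dist_comm]; exact hk2.le)]
        exact ENNReal.ofReal_le_ofReal
          (Real.rpow_le_rpow_of_nonpos (by positivity) hk1 (by linarith))
    _ = ∑' k : ℕ, ENNReal.ofReal (((2 : ℝ) ^ k) ^ (-γ))
          * μ (Metric.closedBall x ((2 : ℝ) ^ (k + 1))) := by
        rw [lintegral_tsum fun k => (measurable_const.indicator
          Metric.isClosed_closedBall.measurableSet).aemeasurable]
        simp_rw [lintegral_indicator_const Metric.isClosed_closedBall.measurableSet]
    _ ≤ _ := by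
        refine ENNReal.tsum_le_tsum fun k => ?_
        refine (mul_le_mul_right (hμ x _ (by positivity)) _).trans (le_of_eq ?_)
        rw [mul_left_comm, ← ENNReal.ofReal_mul (by positivity)]
        congr 2
        rw [← Real.rpow_natCast 2, ← Real.rpow_natCast 2, ← Real.rpow_natCast (_ ^ _),
          ← Real.rpow_mul (by norm_num), ← Real.rpow_mul (by norm_num),
          ← Real.rpow_mul (by norm_num), ← Real.rpow_add (by norm_num),
          ← Real.rpow_add (by norm_num)]
        congr 1; push_cast; ring

theorem setLIntegral_truncated_kernel_le {E : Type*} [NormedAddCommGroup E] [MeasurableSpace E]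
    [OpensMeasurableSpace E] {μ : Measure E} {C : NNReal} {N s : ℝ} (hN : 2 ≤ N) (hs : 0 < s)
    (hμ : ∀ x : E, ∀ r : ℝ, 0 < r → μ (Metric.closedBall x r) ≤ C * ENNReal.ofReal (r ^ (N - 1)))
    (hμ0 : μ {0} = 0) {ε b W : ℝ} (hε : 0 < ε) (hb : 0 < b) (hW : 0 ≤ W) :
    ∃ K : NNReal, ∀ x : E, ‖x‖ ≤ b → ∫⁻ y in {y | ε ≤ dist x y},
      ENNReal.ofReal ((W + ‖y‖ ^ (-((N - 2 - s) / 2))) / dist x y ^ (N + s)) ∂μ ≤ K := by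
  obtain ⟨K₁, hK₁⟩ := setLIntegral_rpow_neg_dist_ball_le (γ := N - 1 - min s 1 / 2) hμ
    (by linarith [min_le_right s 1]) (by linarith [lt_min hs one_pos])
  obtain ⟨K₂, hK₂⟩ := setLIntegral_rpow_neg_dist_compl_ball_le (γ := N + s / 2) hμ
    (by linarith) (by linarith)
  set A : ℝ := (W + 1) * ε ^ (-(N + s)) with hA
  set B : ℝ := (W + 1) * (b / ε + 1) ^ (N + s) with hB
  have hA0 : 0 ≤ A := by positivity
  have hB0 : 0 ≤ B := by positivity
  refine ⟨A.toNNReal * K₁ + B.toNNReal * K₂, fun x hx => ?_⟩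
  have m1 : MeasurableSet {y : E | dist 0 y ≤ 1} :=
    (isClosed_le (by fun_prop) continuous_const).measurableSet
  have m2 : MeasurableSet {y : E | 1 ≤ dist 0 y} :=
    (isClosed_le continuous_const (by fun_prop)).measurableSet
  have m3 : MeasurableSet {y : E | ε ≤ dist x y} :=
    (isClosed_le continuous_const (by fun_prop)).measurableSet
  have hm (γ : ℝ) : Measurable fun y : E => ENNReal.ofReal (dist 0 y ^ (-γ)) := by
    have : Measurable fun y : E => dist 0 y := (by fun_prop : Continuous _).measurable
    fun_prop
  calc _ ≤ ∫⁻ y, (ENNReal.ofReal A * {y : E | dist 0 y ≤ 1}.indicator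
              (fun y => ENNReal.ofReal (dist 0 y ^ (-(N - 1 - min s 1 / 2)))) y
            + ENNReal.ofReal B * {y : E | 1 ≤ dist 0 y}.indicator
              (fun y => ENNReal.ofReal (dist 0 y ^ (-(N + s / 2)))) y) ∂μ := by
        rw [← lintegral_indicator m3]
        refine lintegral_mono_ae ?_
        have h0 : ∀ᵐ y ∂μ, y ≠ 0 := by
          rw [ae_iff]; simpa using hμ0
        filter_upwards [h0] with y hy0
        by_cases hy : y ∈ {y | ε ≤ dist x y}
        swap
        · rw [Set.indicator_of_notMem hy]; exact zero_le
        rw [Set.indicator_of_mem hy]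
        have hy' : ε ≤ dist x y := hy
        have hd : 0 < dist x y := hε.trans_le hy'
        have hyn : 0 < ‖y‖ := norm_pos_iff.2 hy0
        rcases le_total ‖y‖ 1 with h1 | h1
        · refine le_trans ?_ le_self_add
          rw [Set.indicator_of_mem (by simpa using h1), ← ENNReal.ofReal_mul hA0]
          refine ENNReal.ofReal_le_ofReal ?_
          rw [dist_zero_left, div_eq_mul_inv, ← Real.rpow_neg hd.le]
          have e1 : dist x y ^ (-(N + s)) ≤ ε ^ (-(N + s)) :=
            Real.rpow_le_rpow_of_nonpos hε hy' (by linarith)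
          have e2 : ‖y‖ ^ (-((N - 2 - s) / 2)) ≤ ‖y‖ ^ (-(N - 1 - min s 1 / 2)) :=
            Real.rpow_le_rpow_of_exponent_ge hyn h1 (by linarith [min_le_left s 1])
          have e3 : 1 ≤ ‖y‖ ^ (-(N - 1 - min s 1 / 2)) :=
            Real.one_le_rpow_of_pos_of_le_one_of_nonpos hyn h1 (by linarith [min_le_right s 1])
          calc _ ≤ ((W + 1) * ‖y‖ ^ (-(N - 1 - min s 1 / 2))) * ε ^ (-(N + s)) := by
                gcongr; nlinarith
            _ = _ := by rw [hA]; ring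
        · refine le_trans ?_ le_add_self
          rw [Set.indicator_of_mem (by simpa using h1), ← ENNReal.ofReal_mul hB0]
          refine ENNReal.ofReal_le_ofReal ?_
          rw [dist_zero_left, div_eq_mul_inv, ← Real.rpow_neg hd.le]
          have e0 : ‖y‖ ≤ (b / ε + 1) * dist x y := by
            have h2 : ‖y‖ ≤ ‖x‖ + dist x y := by
              rw [dist_eq_norm']; simpa using norm_add_le x (y - x)
            have h3 : b ≤ b / ε * dist x y := by
              rw [div_mul_eq_mul_div, le_div_iff₀ hε]; gcongr
            linarith
          have e1 : dist x y ^ (-(N + s)) ≤ (b / ε + 1) ^ (N + s) * ‖y‖ ^ (-(N + s)) := by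
            have := Real.rpow_le_rpow_of_nonpos hyn e0 (by linarith : -(N + s) ≤ 0)
            rw [Real.mul_rpow (by positivity) hd.le, Real.rpow_neg (by positivity)] at this
            calc _ = (b / ε + 1) ^ (N + s)
                  * (((b / ε + 1) ^ (N + s))⁻¹ * dist x y ^ (-(N + s))) := by
                  field_simp
              _ ≤ _ := by gcongr
          have e2 : ‖y‖ ^ (-((N - 2 - s) / 2)) ≤ ‖y‖ ^ (s / 2) :=
            Real.rpow_le_rpow_of_exponent_le h1 (by linarith)
          have e3 : 1 ≤ ‖y‖ ^ (s / 2) := Real.one_le_rpow h1 (by linarith)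
          calc _ ≤ ((W + 1) * ‖y‖ ^ (s / 2)) * ((b / ε + 1) ^ (N + s) * ‖y‖ ^ (-(N + s))) := by
                gcongr; nlinarith
            _ = B * (‖y‖ ^ (s / 2) * ‖y‖ ^ (-(N + s))) := by rw [hB]; ring
            _ = _ := by rw [← Real.rpow_add hyn]; congr 2; ring
    _ = ENNReal.ofReal A * ∫⁻ y in {y : E | dist 0 y ≤ 1},
            ENNReal.ofReal (dist 0 y ^ (-(N - 1 - min s 1 / 2))) ∂μ
          + ENNReal.ofReal B * ∫⁻ y in {y : E | 1 ≤ dist 0 y},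
            ENNReal.ofReal (dist 0 y ^ (-(N + s / 2))) ∂μ := by
        rw [lintegral_add_left (((hm _).indicator m1).const_mul _),
          lintegral_const_mul _ ((hm _).indicator m1), lintegral_const_mul _ ((hm _).indicator m2),
          lintegral_indicator m1, lintegral_indicator m2]
    _ ≤ _ := by
        push_cast
        exact add_le_add (mul_le_mul_right (hK₁ 0) _) (mul_le_mul_right (hK₂ 0) _)

theorem lintegral_gagliardo_kernel_le {E : Type*} [PseudoMetricSpace E] [MeasurableSpace E]
    [OpensMeasurableSpace E] {μ : Measure E} {C : NNReal} {N s : ℝ} (hN : 2 ≤ N) (hs : 0 < s)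
    (hs1 : s < 1)
    (hμ : ∀ x : E, ∀ r : ℝ, 0 < r → μ (Metric.closedBall x r) ≤ C * ENNReal.ofReal (r ^ (N - 1)))
    {φ : E → ℝ} {L : NNReal} (hφ : LipschitzWith L φ) {M : ℝ} (hM : ∀ x, |φ x| ≤ M) :
    ∃ K : NNReal, ∀ x : E,
      ∫⁻ y, ENNReal.ofReal ((φ x - φ y) ^ 2 / dist x y ^ (N + s)) ∂μ ≤ K := by
  obtain ⟨K₁, hK₁⟩ := setLIntegral_rpow_neg_dist_ball_le (γ := N + s - 2) hμ
    (by linarith) (by linarith)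
  obtain ⟨K₂, hK₂⟩ := setLIntegral_rpow_neg_dist_compl_ball_le (γ := N + s) hμ
    (by linarith) (by linarith)
  set A : ℝ := (L : ℝ) ^ 2 with hA
  set B : ℝ := (2 * M) ^ 2 with hB
  have hA0 : 0 ≤ A := by positivity
  have hB0 : 0 ≤ B := by positivity
  refine ⟨A.toNNReal * K₁ + B.toNNReal * K₂, fun x => ?_⟩
  have m1 : MeasurableSet {y : E | dist x y ≤ 1} :=
    (isClosed_le (by fun_prop) continuous_const).measurableSet
  have m2 : MeasurableSet {y : E | 1 ≤ dist x y} :=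
    (isClosed_le continuous_const (by fun_prop)).measurableSet
  have hm (γ : ℝ) : Measurable fun y : E => ENNReal.ofReal (dist x y ^ (-γ)) := by
    have : Measurable fun y : E => dist x y := (by fun_prop : Continuous _).measurable
    fun_prop
  calc _ ≤ ∫⁻ y, (ENNReal.ofReal A * {y : E | dist x y ≤ 1}.indicator
              (fun y => ENNReal.ofReal (dist x y ^ (-(N + s - 2)))) y
            + ENNReal.ofReal B * {y : E | 1 ≤ dist x y}.indicator
              (fun y => ENNReal.ofReal (dist x y ^ (-(N + s)))) y) ∂μ := by
        refine lintegral_mono fun y => ?_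
        have hl : |φ x - φ y| ≤ L * dist x y := hφ.dist_le_mul x y
        rcases le_total (dist x y) 1 with h1 | h1
        · refine le_trans ?_ le_self_add
          rw [Set.indicator_of_mem (by simpa using h1), ← ENNReal.ofReal_mul hA0]
          refine ENNReal.ofReal_le_ofReal ?_
          rcases eq_or_lt_of_le (dist_nonneg (x := x) (y := y)) with h0 | h0
          · rw [← h0, Real.zero_rpow (by linarith), div_zero]; positivity
          calc _ ≤ (L * dist x y) ^ 2 / dist x y ^ (N + s) := by
                gcongr ?_ / _
                exact sq_le_sq' (abs_le.1 hl).1 (abs_le.1 hl).2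
            _ = A * (dist x y ^ (2 : ℝ) * dist x y ^ (-(N + s))) := by
                rw [hA, Real.rpow_neg h0.le, Real.rpow_two]; ring
            _ = _ := by rw [← Real.rpow_add h0]; congr 2; ring
        · refine le_trans ?_ le_add_self
          rw [Set.indicator_of_mem (by simpa using h1), ← ENNReal.ofReal_mul hB0]
          refine ENNReal.ofReal_le_ofReal ?_
          rw [Real.rpow_neg dist_nonneg, ← div_eq_mul_inv]
          gcongr ?_ / _
          have hx := abs_le.1 (hM x)
          have hy := abs_le.1 (hM y)
          exact sq_le_sq' (by linarith) (by linarith)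
    _ = ENNReal.ofReal A * ∫⁻ y in {y : E | dist x y ≤ 1},
            ENNReal.ofReal (dist x y ^ (-(N + s - 2))) ∂μ
          + ENNReal.ofReal B * ∫⁻ y in {y : E | 1 ≤ dist x y},
            ENNReal.ofReal (dist x y ^ (-(N + s))) ∂μ := by
        rw [lintegral_add_left (((hm _).indicator m1).const_mul _),
          lintegral_const_mul _ ((hm _).indicator m1), lintegral_const_mul _ ((hm _).indicator m2),
          lintegral_indicator m1, lintegral_indicator m2]
    _ ≤ _ := by
        push_cast
        exact add_le_add (mul_le_mul_right (hK₁ x) _) (mul_le_mul_right (hK₂ x) _)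

theorem integrable_gagliardo_kernel {E : Type*} [NormedAddCommGroup E] [MeasurableSpace E]
    [BorelSpace E] [SecondCountableTopology E] {μ : Measure E} [SFinite μ] {C : NNReal} {N s : ℝ}
    (hN : 2 ≤ N) (hs : 0 < s) (hs1 : s < 1)
    (hμ : ∀ x : E, ∀ r : ℝ, 0 < r → μ (Metric.closedBall x r) ≤ C * ENNReal.ofReal (r ^ (N - 1)))
    {φ : E → ℝ} {L : NNReal} (hφ : LipschitzWith L φ) {M : ℝ} (hM : ∀ x, |φ x| ≤ M)
    {b : ℝ} (hb : 0 < b) (hφb : ∀ x, φ x ≠ 0 → ‖x‖ ≤ b) :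
    Integrable (fun z : E × E => (φ z.1 - φ z.2) ^ 2 / dist z.1 z.2 ^ (N + s)) (μ.prod μ) := by
  obtain ⟨K, hK⟩ := lintegral_gagliardo_kernel_le hN hs hs1 hμ hφ hM
  have hφm : Measurable φ := hφ.continuous.measurable
  have hmeas : Measurable fun z : E × E => (φ z.1 - φ z.2) ^ 2 / dist z.1 z.2 ^ (N + s) := by
    fun_prop
  refine ⟨hmeas.aestronglyMeasurable, ?_⟩
  rw [hasFiniteIntegral_iff_ofReal (ae_of_all _ fun z => by positivity)]
  set f : E × E → ENNReal :=
    fun z => ENNReal.ofReal ((φ z.1 - φ z.2) ^ 2 / dist z.1 z.2 ^ (N + s)) with hf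
  have hfm : Measurable f := hmeas.ennreal_ofReal
  set g : E × E → ENNReal := fun z => (Metric.closedBall (0 : E) b).indicator 1 z.1 * f z with hg
  have hgm : Measurable g := by
    refine Measurable.mul ?_ hfm
    exact (measurable_one.indicator Metric.isClosed_closedBall.measurableSet).comp measurable_fst
  have h1 : ∫⁻ z, g z ∂(μ.prod μ) < ⊤ := by
    rw [lintegral_prod _ hgm.aemeasurable]
    calc _ ≤ ∫⁻ x, (Metric.closedBall (0 : E) b).indicator (fun _ => (K : ENNReal)) x ∂μ := by
          refine lintegral_mono fun x => ?_
          simp only [hg]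
          have hfx : Measurable fun y => f (x, y) := hfm.comp measurable_prodMk_left
          rw [lintegral_const_mul _ hfx]
          by_cases hx : x ∈ Metric.closedBall (0 : E) b
          · simpa [Set.indicator_of_mem hx] using hK x
          · simp [Set.indicator_of_notMem hx]
      _ = K * μ (Metric.closedBall 0 b) :=
          lintegral_indicator_const Metric.isClosed_closedBall.measurableSet _
      _ < ⊤ := ENNReal.mul_lt_top ENNReal.coe_lt_top
          ((hμ 0 b hb).trans_lt (ENNReal.mul_lt_top ENNReal.coe_lt_top ENNReal.ofReal_lt_top))
  calc ∫⁻ z, f z ∂(μ.prod μ) ≤ ∫⁻ z, (g z + g z.swap) ∂(μ.prod μ) := by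
        refine lintegral_mono fun z => ?_
        have hsw : f z.swap = f z := by
          simp only [hf, Prod.fst_swap, Prod.snd_swap, dist_comm z.2 z.1]
          congr 2; ring
        simp only [hg, hsw, Prod.fst_swap]
        by_cases hx : z.1 ∈ Metric.closedBall (0 : E) b
        · simp [Set.indicator_of_mem hx]
        by_cases hy : z.2 ∈ Metric.closedBall (0 : E) b
        · simp [Set.indicator_of_mem hy]
        have hx' : φ z.1 = 0 := by
          by_contra h; exact hx (by simpa using hφb _ h)
        have hy' : φ z.2 = 0 := by
          by_contra h; exact hy (by simpa using hφb _ h)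
        simp [hf, hx', hy']
    _ = ∫⁻ z, g z ∂(μ.prod μ) + ∫⁻ z, g z ∂(μ.prod μ) := by
        rw [lintegral_add_left hgm, lintegral_prod_swap]
    _ < ⊤ := ENNReal.add_lt_top.2 ⟨h1, h1⟩

theorem ground_state_inequality {a b w v : ℝ} (hw : 0 ≤ w) (hv : 0 ≤ v)
    (hwa : a ≠ 0 → w ≠ 0) (hvb : b ≠ 0 → v ≠ 0) :
    (w - v) * (a ^ 2 * w⁻¹) + (v - w) * (b ^ 2 * v⁻¹) ≤ (a - b) ^ 2 := by
  have key : ∀ c u : ℝ, (c ≠ 0 → u ≠ 0) → c ^ 2 * u⁻¹ * u = c ^ 2 := by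
    intro c u h
    rcases eq_or_ne c 0 with rfl | hc
    · simp
    · have := h hc
      field_simp
  have h1 := key a w hwa
  have h2 := key b v hvb
  have h3 : 2 * (a * b) ≤ v * (a ^ 2 * w⁻¹) + w * (b ^ 2 * v⁻¹) := by
    rcases eq_or_ne a 0 with rfl | ha
    · simp only [zero_mul, mul_zero]; positivity
    rcases eq_or_ne b 0 with rfl | hb
    · simp only [mul_zero]; positivity
    have hw' : 0 < w := lt_of_le_of_ne hw (hwa ha).symm
    have hv' : 0 < v := lt_of_le_of_ne hv (hvb hb).symm
    have : v * (a ^ 2 * w⁻¹) + w * (b ^ 2 * v⁻¹) - 2 * (a * b)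
        = (v * a - w * b) ^ 2 / (v * w) := by field_simp; ring
    have h4 : 0 ≤ (v * a - w * b) ^ 2 / (v * w) := by positivity
    linarith
  nlinarith

theorem integrable_truncated_ground_state {E : Type*} [NormedAddCommGroup E] [MeasurableSpace E]
    [BorelSpace E] [SecondCountableTopology E] {μ : Measure E} [SFinite μ] {C : NNReal} {N s : ℝ}
    (hN : 2 ≤ N) (hs : 0 < s)
    (hμ : ∀ x : E, ∀ r : ℝ, 0 < r → μ (Metric.closedBall x r) ≤ C * ENNReal.ofReal (r ^ (N - 1)))
    (hμ0 : μ {0} = 0) {φ : E → ℝ} (hφ : Measurable φ) {M : ℝ} (hM : ∀ x, |φ x| ≤ M)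
    {a b : ℝ} (ha : 0 < a) (hb : 0 < b) (hφab : ∀ x, φ x ≠ 0 → a ≤ ‖x‖ ∧ ‖x‖ ≤ b)
    {ε : ℝ} (hε : 0 < ε) :
    Integrable ({z : E × E | ε ≤ dist z.1 z.2}.indicator fun z =>
      (‖z.1‖ ^ (-((N - 2 - s) / 2)) - ‖z.2‖ ^ (-((N - 2 - s) / 2)))
        * (φ z.1 ^ 2 * (‖z.1‖ ^ (-((N - 2 - s) / 2)))⁻¹) / dist z.1 z.2 ^ (N + s))
      (μ.prod μ) := by
  set β := (N - 2 - s) / 2 with hβ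
  have hpow (q : ℝ) {x : E} (hx : φ x ≠ 0) : ‖x‖ ^ q ≤ a ^ q + b ^ q := by
    obtain ⟨h1, h2⟩ := hφab x hx
    rcases le_total 0 q with hq | hq
    · have := Real.rpow_le_rpow (norm_nonneg x) h2 hq
      have : 0 ≤ a ^ q := by positivity
      linarith
    · have := Real.rpow_le_rpow_of_nonpos ha h1 hq
      have : 0 ≤ b ^ q := by positivity
      linarith
  set W := a ^ (-β) + b ^ (-β) with hW
  set G := M ^ 2 * (a ^ β + b ^ β) with hG
  have hW0 : 0 ≤ W := by positivity
  have hG0 : 0 ≤ G := by positivity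
  obtain ⟨K, hK⟩ := setLIntegral_truncated_kernel_le hN hs hμ hμ0 hε hb hW0
  have hmset : MeasurableSet {z : E × E | ε ≤ dist z.1 z.2} :=
    (isClosed_le continuous_const (by fun_prop)).measurableSet
  set F : E × E → ℝ := {z : E × E | ε ≤ dist z.1 z.2}.indicator fun z =>
      (‖z.1‖ ^ (-β) - ‖z.2‖ ^ (-β)) * (φ z.1 ^ 2 * (‖z.1‖ ^ (-β))⁻¹) / dist z.1 z.2 ^ (N + s)
    with hF
  have hFm : Measurable F := Measurable.indicator (by fun_prop) hmset
  refine ⟨hFm.aestronglyMeasurable, ?_⟩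
  rw [HasFiniteIntegral, lintegral_prod _ hFm.enorm.aemeasurable]
  calc _ ≤ ∫⁻ x, (Metric.closedBall (0 : E) b).indicator
          (fun _ => ENNReal.ofReal G * (K : ENNReal)) x ∂μ := by
        refine lintegral_mono fun x => ?_
        by_cases hx : φ x = 0
        · simp [hF, hx, Set.indicator]
        rw [Set.indicator_of_mem (by simpa using (hφab x hx).2)]
        have hm3 : MeasurableSet {y : E | ε ≤ dist x y} :=
          (isClosed_le continuous_const (by fun_prop)).measurableSet
        calc _ ≤ ∫⁻ y, ENNReal.ofReal G * {y : E | ε ≤ dist x y}.indicator (fun y =>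
                ENNReal.ofReal ((W + ‖y‖ ^ (-β)) / dist x y ^ (N + s))) y ∂μ := by
              refine lintegral_mono fun y => ?_
              by_cases hy : ε ≤ dist x y
              swap
              · have : (x, y) ∉ {z : E × E | ε ≤ dist z.1 z.2} := hy
                simp [hF, this]
              have h1 : (x, y) ∈ {z : E × E | ε ≤ dist z.1 z.2} := hy
              have h2 : y ∈ {y : E | ε ≤ dist x y} := hy
              simp only [hF, Set.indicator_of_mem h1, Set.indicator_of_mem h2]
              rw [← ENNReal.ofReal_mul hG0, Real.enorm_eq_ofReal_abs]
              refine ENNReal.ofReal_le_ofReal ?_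
              have hd : 0 ≤ dist x y ^ (N + s) := by positivity
              rw [abs_div, abs_mul, abs_of_nonneg hd, ← mul_div_assoc]
              gcongr ?_ / _
              rw [mul_comm]
              have e1 : (‖x‖ ^ (-β))⁻¹ ≤ a ^ β + b ^ β := by
                rw [Real.rpow_neg (norm_nonneg x), inv_inv]; exact hpow β hx
              have e2 : φ x ^ 2 ≤ M ^ 2 := by
                rw [← sq_abs]; gcongr; exact hM x
              have e3 : |φ x ^ 2 * (‖x‖ ^ (-β))⁻¹| ≤ G := by
                rw [abs_of_nonneg (by positivity), hG]; gcongr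
              have e4 : |‖x‖ ^ (-β) - ‖y‖ ^ (-β)| ≤ W + ‖y‖ ^ (-β) := by
                have := hpow (-β) hx
                have h5 : 0 ≤ ‖x‖ ^ (-β) := by positivity
                have h6 : 0 ≤ ‖y‖ ^ (-β) := by positivity
                rw [abs_le]; constructor <;> linarith
              gcongr
          _ = ENNReal.ofReal G * ∫⁻ y in {y : E | ε ≤ dist x y},
                ENNReal.ofReal ((W + ‖y‖ ^ (-β)) / dist x y ^ (N + s)) ∂μ := by
              rw [lintegral_const_mul _ (Measurable.indicator (by fun_prop) hm3),
                lintegral_indicator hm3]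
          _ ≤ _ := by gcongr; exact hK x (hφab x hx).2
    _ = (ENNReal.ofReal G * K) * μ (Metric.closedBall 0 b) :=
        lintegral_indicator_const Metric.isClosed_closedBall.measurableSet _
    _ < ⊤ := ENNReal.mul_lt_top (ENNReal.mul_lt_top ENNReal.ofReal_lt_top ENNReal.coe_lt_top)
          ((hμ 0 b hb).trans_lt (ENNReal.mul_lt_top ENNReal.coe_lt_top ENNReal.ofReal_lt_top))

theorem fractional_hardy_of_truncated_identity {E : Type*} [NormedAddCommGroup E]
    [MeasurableSpace E] [BorelSpace E] [SecondCountableTopology E] {μ : Measure E} [SFinite μ]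
    {C : NNReal} {N s : ℝ} (hN : 2 ≤ N) (hs : 0 < s) (hs1 : s < 1)
    (hμ : ∀ x : E, ∀ r : ℝ, 0 < r → μ (Metric.closedBall x r) ≤ C * ENNReal.ofReal (r ^ (N - 1)))
    (hμ0 : μ {0} = 0) {h : ℝ → ℝ} {H : ℝ} (hh : Tendsto h (𝓝[>] 0) (𝓝 H))
    (hid : ∀ᵐ x ∂μ, x ≠ 0 → ∀ ε > 0, ∫ y in {y | ε ≤ dist x y},
      (‖x‖ ^ (-((N - 2 - s) / 2)) - ‖y‖ ^ (-((N - 2 - s) / 2))) / dist x y ^ (N + s) ∂μ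
        = ‖x‖ ^ (-((N - 2 - s) / 2)) / ‖x‖ ^ (1 + s) * h (ε / ‖x‖))
    {φ : E → ℝ} {L : NNReal} (hφ : LipschitzWith L φ) {M : ℝ} (hM : ∀ x, |φ x| ≤ M)
    {a b : ℝ} (ha : 0 < a) (hb : 0 < b) (hφab : ∀ x, φ x ≠ 0 → a ≤ ‖x‖ ∧ ‖x‖ ≤ b) :
    H * ∫ x, φ x ^ 2 / ‖x‖ ^ (1 + s) ∂μ ≤
      1 / 2 * ∫ x, (∫ y, (φ x - φ y) ^ 2 / dist x y ^ (N + s) ∂μ) ∂μ := by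
  have hφm : Measurable φ := hφ.continuous.measurable
  set J := ∫ x, φ x ^ 2 / ‖x‖ ^ (1 + s) ∂μ with hJ
  have hJ0 : 0 ≤ J := integral_nonneg fun x => by positivity
  have hJi : Integrable (fun x => φ x ^ 2 / ‖x‖ ^ (1 + s)) μ := by
    have hball : μ (Metric.closedBall 0 b) < ⊤ :=
      (hμ 0 b hb).trans_lt (ENNReal.mul_lt_top ENNReal.coe_lt_top ENNReal.ofReal_lt_top)
    have hm : Measurable fun x => φ x ^ 2 / ‖x‖ ^ (1 + s) := by fun_prop
    refine Integrable.mono' (g := (Metric.closedBall (0 : E) b).indicator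
      fun _ => M ^ 2 / a ^ (1 + s)) ?_ hm.aestronglyMeasurable (ae_of_all _ fun x => ?_)
    · exact (integrable_indicator_iff Metric.isClosed_closedBall.measurableSet).2
        (integrableOn_const hball.ne)
    · by_cases hx : φ x = 0
      · simp only [hx]
        refine le_trans (by simp) (Set.indicator_nonneg (fun _ _ => by positivity) x)
      obtain ⟨h1, h2⟩ := hφab x hx
      rw [Set.indicator_of_mem (by simpa using h2), Real.norm_of_nonneg (by positivity)]
      have : φ x ^ 2 ≤ M ^ 2 := by
        rw [← sq_abs]; gcongr; exact hM x
      gcongr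
  have hfi := integrable_gagliardo_kernel hN hs hs1 hμ hφ hM hb fun x hx => (hφab x hx).2
  have key : ∀ η > 0, (H - η) * J ≤
      1 / 2 * ∫ x, (∫ y, (φ x - φ y) ^ 2 / dist x y ^ (N + s) ∂μ) ∂μ := by
    intro η hη
    have hev : ∀ᶠ δ in 𝓝[>] (0 : ℝ), H - η < h δ := hh.eventually (lt_mem_nhds (by linarith))
    obtain ⟨δ, hδ, hδh⟩ := mem_nhdsGT_iff_exists_Ioc_subset.1 hev
    have hδ0 : 0 < δ := hδ
    set ε := δ * a with hε'
    have hε : 0 < ε := by positivity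
    have hFi := integrable_truncated_ground_state hN hs hμ hμ0 hφm hM ha hb hφab hε
    set β := (N - 2 - s) / 2 with hβ
    set F : E × E → ℝ := {z : E × E | ε ≤ dist z.1 z.2}.indicator fun z =>
        (‖z.1‖ ^ (-β) - ‖z.2‖ ^ (-β)) * (φ z.1 ^ 2 * (‖z.1‖ ^ (-β))⁻¹) / dist z.1 z.2 ^ (N + s)
      with hF
    have hlow : (H - η) * J ≤ ∫ x, ∫ y, F (x, y) ∂μ ∂μ := by
      rw [hJ, ← integral_const_mul]
      refine integral_mono_ae (hJi.const_mul _) hFi.integral_prod_left ?_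
      filter_upwards [hid] with x hx
      by_cases hφx : φ x = 0
      · simp [hF, hφx, Set.indicator]
      obtain ⟨h1, h2⟩ := hφab x hφx
      have hxn : 0 < ‖x‖ := ha.trans_le h1
      have hm3 : MeasurableSet {y : E | ε ≤ dist x y} :=
        (isClosed_le continuous_const (by fun_prop)).measurableSet
      have e1 : ∫ y, F (x, y) ∂μ = φ x ^ 2 / ‖x‖ ^ (1 + s) * h (ε / ‖x‖) := by
        calc _ = ∫ y, (φ x ^ 2 * (‖x‖ ^ (-β))⁻¹) * {y : E | ε ≤ dist x y}.indicator (fun y =>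
                (‖x‖ ^ (-β) - ‖y‖ ^ (-β)) / dist x y ^ (N + s)) y ∂μ := by
              congr 1; ext y
              simp only [hF, Set.indicator, Set.mem_ofPred_eq]
              split_ifs
              · ring
              · ring
          _ = _ := by
              rw [integral_const_mul, integral_indicator hm3, hx (norm_pos_iff.1 hxn) ε hε]
              have : ‖x‖ ^ (-β) ≠ 0 := by positivity
              field_simp
      have e2 : H - η < h (ε / ‖x‖) := by
        refine hδh ⟨by positivity, ?_⟩
        rw [div_le_iff₀ hxn, hε']; gcongr
      simp only [e1]
      rw [mul_comm]
      gcongr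
    rw [← integral_prod _ hFi] at hlow
    rw [← integral_prod (fun z : E × E => (φ z.1 - φ z.2) ^ 2 / dist z.1 z.2 ^ (N + s)) hfi]
    have hsym : ∫ z, (F z + F z.swap) ∂(μ.prod μ) = 2 * ∫ z, F z ∂(μ.prod μ) := by
      have h1 : ∫ z, F z.swap ∂(μ.prod μ) = ∫ z, F z ∂(μ.prod μ) := integral_prod_swap F
      have h2 := integral_add hFi hFi.swap
      simp only [Function.comp_apply, h1] at h2
      rw [h2, two_mul]
    have hmono : ∫ z, (F z + F z.swap) ∂(μ.prod μ)
        ≤ ∫ z : E × E, (φ z.1 - φ z.2) ^ 2 / dist z.1 z.2 ^ (N + s) ∂(μ.prod μ) := by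
      refine integral_mono (hFi.add hFi.swap) hfi fun z => ?_
      obtain ⟨x, y⟩ := z
      simp only [hF, Set.indicator, Set.mem_ofPred_eq, Prod.fst_swap, Prod.snd_swap, dist_comm y x]
      split_ifs
      swap
      · simp only [add_zero]; positivity
      rw [← add_div]
      gcongr ?_ / _
      have hne : ∀ u, φ u ≠ 0 → ‖u‖ ^ (-β) ≠ 0 := fun u hu =>
        (Real.rpow_pos_of_pos (ha.trans_le (hφab u hu).1) _).ne'
      exact ground_state_inequality (by positivity) (by positivity) (hne x) (hne y)
    linarith
  by_contra! hcon
  set R := 1 / 2 * ∫ x, (∫ y, (φ x - φ y) ^ 2 / dist x y ^ (N + s) ∂μ) ∂μ with hR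
  have h1 := key ((H * J - R) / (2 * (J + 1))) (by apply div_pos <;> linarith)
  have h2 : (H * J - R) / (2 * (J + 1)) * J ≤ (H * J - R) / 2 := by
    rw [div_mul_eq_mul_div, div_le_div_iff₀ (by linarith) (by norm_num)]
    nlinarith
  linarith

theorem abs_sub_le_of_mem_cone_of_max_coord {m n : ℕ} {α : ℝ} (hα : 0 < α)
    {x x' : Fin m ⊕ Fin n → ℝ} {i : Fin n}
    (hx : ∑ j, x (Sum.inr j) ^ 2 = α ^ 2 * ∑ k, x (Sum.inl k) ^ 2)
    (hx' : ∑ j, x' (Sum.inr j) ^ 2 = α ^ 2 * ∑ k, x' (Sum.inl k) ^ 2)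
    (hi : ∀ j, |x (Sum.inr j)| ≤ |x (Sum.inr i)|) (hi' : ∀ j, |x' (Sum.inr j)| ≤ |x' (Sum.inr i)|)
    (hsign : 0 ≤ x (Sum.inr i) * x' (Sum.inr i)) {D : ℝ} (hD : 0 ≤ D)
    (h : ∀ j, j ≠ Sum.inr i → |x j - x' j| ≤ D) :
    |x (Sum.inr i) - x' (Sum.inr i)| ≤ (α * m * n + n) * D := by
  have hn : (1 : ℝ) ≤ n := by
    exact_mod_cast Nat.one_le_iff_ne_zero.2 (by rintro rfl; exact i.elim0)
  have hbound : ∀ v : Fin m ⊕ Fin n → ℝ,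
      ∑ j, v (Sum.inr j) ^ 2 = α ^ 2 * ∑ k, v (Sum.inl k) ^ 2 →
      (∀ j, |v (Sum.inr j)| ≤ |v (Sum.inr i)|) → ∀ k, α * |v (Sum.inl k)| ≤ n * |v (Sum.inr i)| := by
    intro v hv hvi k
    refine abs_le_of_sq_le_sq' ?_ (by positivity) |>.2
    have h1 : v (Sum.inl k) ^ 2 ≤ ∑ k, v (Sum.inl k) ^ 2 :=
      Finset.single_le_sum (f := fun k => v (Sum.inl k) ^ 2) (fun _ _ => sq_nonneg _)
        (Finset.mem_univ k)
    have h2 : ∑ j : Fin n, v (Sum.inr j) ^ 2 ≤ n * v (Sum.inr i) ^ 2 := by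
      calc _ ≤ ∑ _j : Fin n, v (Sum.inr i) ^ 2 := Finset.sum_le_sum fun j _ => sq_le_sq.2 (hvi j)
        _ = _ := by simp
    rw [mul_pow, mul_pow, sq_abs, sq_abs]
    have h3 : α ^ 2 * v (Sum.inl k) ^ 2 ≤ α ^ 2 * ∑ k, v (Sum.inl k) ^ 2 := by gcongr
    nlinarith [mul_nonneg (by linarith : (0 : ℝ) ≤ n - 1) (by linarith : (0 : ℝ) ≤ n),
      sq_nonneg (v (Sum.inr i))]
  set T := |x (Sum.inr i)| + |x' (Sum.inr i)| with hT
  have hT0 : 0 ≤ T := by positivity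
  have hfac : |x (Sum.inr i) ^ 2 - x' (Sum.inr i) ^ 2| = |x (Sum.inr i) - x' (Sum.inr i)| * T := by
    rw [sq_sub_sq, abs_mul, mul_comm, abs_add_eq_add_abs_iff _ _ |>.2]
    rcases mul_nonneg_iff.1 hsign with h | h
    · exact Or.inl h
    · exact Or.inr h
  have hdiff : x (Sum.inr i) ^ 2 - x' (Sum.inr i) ^ 2
      = α ^ 2 * ∑ k, (x (Sum.inl k) ^ 2 - x' (Sum.inl k) ^ 2)
        - ∑ j ∈ Finset.univ.erase i, (x (Sum.inr j) ^ 2 - x' (Sum.inr j) ^ 2) := by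
    have e := Finset.add_sum_erase Finset.univ (fun j => x (Sum.inr j) ^ 2 - x' (Sum.inr j) ^ 2)
      (Finset.mem_univ i)
    simp only [Finset.sum_sub_distrib] at e ⊢
    rw [mul_sub, ← hx, ← hx']
    linarith
  have hl : |α ^ 2 * ∑ k, (x (Sum.inl k) ^ 2 - x' (Sum.inl k) ^ 2)| ≤ α * m * n * D * T := by
    rw [abs_mul, abs_of_nonneg (sq_nonneg α)]
    calc _ ≤ α ^ 2 * ∑ k : Fin m, D * (n * T / α) := by
          gcongr
          refine (Finset.abs_sum_le_sum_abs _ _).trans (Finset.sum_le_sum fun k _ => ?_)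
          rw [sq_sub_sq, abs_mul, mul_comm]
          gcongr
          · exact h _ (by simp)
          · refine (abs_add_le _ _).trans ?_
            rw [le_div_iff₀ hα, hT]
            linarith [hbound x hx hi k, hbound x' hx' hi' k]
      _ = _ := by
          simp only [Finset.sum_const, Finset.card_univ, Fintype.card_fin, nsmul_eq_mul]
          field_simp
  have hr : |∑ j ∈ Finset.univ.erase i, (x (Sum.inr j) ^ 2 - x' (Sum.inr j) ^ 2)| ≤ n * D * T := by
    calc _ ≤ ∑ j ∈ Finset.univ.erase i, D * T := by
          refine (Finset.abs_sum_le_sum_abs _ _).trans (Finset.sum_le_sum fun j hj => ?_)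
          rw [sq_sub_sq, abs_mul, mul_comm]
          gcongr
          · exact h _ (by simpa using (Finset.mem_erase.1 hj).1)
          · exact (abs_add_le _ _).trans (add_le_add (hi j) (hi' j))
      _ ≤ ∑ j : Fin n, D * T := Finset.sum_le_sum_of_subset_of_nonneg (Finset.erase_subset _ _)
          fun _ _ _ => by positivity
      _ = _ := by simp; ring
  rcases eq_or_lt_of_le hT0 with h0 | h0
  · have h1 : x (Sum.inr i) = 0 :=
      abs_eq_zero.1 (by linarith [abs_nonneg (x (Sum.inr i)), abs_nonneg (x' (Sum.inr i))])
    have h2 : x' (Sum.inr i) = 0 :=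
      abs_eq_zero.1 (by linarith [abs_nonneg (x (Sum.inr i)), abs_nonneg (x' (Sum.inr i))])
    rw [h1, h2]; simp; positivity
  · refine le_of_mul_le_mul_right ?_ h0
    rw [← hfac, hdiff]
    refine (abs_sub _ _).trans ?_
    linarith

theorem hausdorffMeasure_inter_closedBall_le_of_coord_antilipschitz {ι : Type*} [Fintype ι]
    [DecidableEq ι] (i : ι) {P : Set (EuclideanSpace ℝ ι)} {K : NNReal}
    (hP : ∀ x ∈ P, ∀ x' ∈ P, dist x x' ≤
      K * dist (fun j : {j // j ≠ i} => x j.1) (fun j : {j // j ≠ i} => x' j.1))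
    {d : ℝ} (hd : d = (Fintype.card ι : ℝ) - 1) (x₀ : EuclideanSpace ℝ ι) {r : ℝ} (hr : 0 < r) :
    Measure.hausdorffMeasure d (P ∩ Metric.closedBall x₀ r)
      ≤ (K : ENNReal) ^ d * ENNReal.ofReal (2 ^ d) * ENNReal.ofReal (r ^ d) := by
  have hcard : d = (Fintype.card {j // j ≠ i} : ℝ) := by
    have : Fintype.card {j // j ≠ i} + 1 = Fintype.card ι := by
      rw [Fintype.card_subtype_compl, Fintype.card_subtype_eq]
      exact Nat.sub_add_cancel (Fintype.card_pos_iff.2 ⟨i⟩)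
    rw [hd, ← this]; push_cast; ring
  have hd0 : 0 ≤ d := by rw [hcard]; positivity
  set f : P → ({j // j ≠ i} → ℝ) := fun x j => (x : EuclideanSpace ℝ ι) j with hf
  have hanti : AntilipschitzWith K f :=
    AntilipschitzWith.of_le_mul_dist fun x y => hP x x.2 y y.2
  set A : Set P := Subtype.val ⁻¹' Metric.closedBall x₀ r with hA
  have himg : f '' A ⊆ Metric.closedBall (fun j : {j // j ≠ i} => x₀ j) r := by
    rintro _ ⟨x, hx, rfl⟩
    rw [Metric.mem_closedBall, dist_pi_le_iff hr.le]
    intro j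
    have h1 : dist (x : EuclideanSpace ℝ ι) x₀ ≤ r := hx
    refine le_trans ?_ h1
    have := PiLp.norm_apply_le ((x : EuclideanSpace ℝ ι) - x₀) j
    simpa [dist_eq_norm] using this
  calc Measure.hausdorffMeasure d (P ∩ Metric.closedBall x₀ r)
      = Measure.hausdorffMeasure d (Subtype.val '' A) := by
        rw [hA, Subtype.image_preimage_coe]
    _ = Measure.hausdorffMeasure d A :=
        isometry_subtype_coe.hausdorffMeasure_image (Or.inl hd0) A
    _ ≤ (K : ENNReal) ^ d * Measure.hausdorffMeasure d (f '' A) :=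
        hanti.le_hausdorffMeasure_image hd0 A
    _ ≤ (K : ENNReal) ^ d * Measure.hausdorffMeasure d
          (Metric.closedBall (fun j : {j // j ≠ i} => x₀ j) r) := by gcongr
    _ = _ := by
        rw [mul_assoc]
        congr 1
        rw [hcard, hausdorffMeasure_pi_real, Real.volume_pi_closedBall _ hr.le, mul_pow,
          ENNReal.ofReal_mul (by positivity)]
        simp only [Real.rpow_natCast]

theorem hausdorffMeasure_cone_inter_closedBall_le {m n : ℕ} {α : ℝ} (hα : 0 < α)
    {S : Set (EuclideanSpace ℝ (Fin m ⊕ Fin n))} (hn : 1 ≤ n)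
    (hS : ∀ x ∈ S, ∑ j, x (Sum.inr j) ^ 2 = α ^ 2 * ∑ k, x (Sum.inl k) ^ 2) :
    ∃ C : NNReal, ∀ x : EuclideanSpace ℝ (Fin m ⊕ Fin n), ∀ r : ℝ, 0 < r →
      (Measure.hausdorffMeasure ((m + n : ℝ) - 1)) (S ∩ Metric.closedBall x r)
        ≤ C * ENNReal.ofReal (r ^ ((m + n : ℝ) - 1)) := by
  set c : ℝ := max 1 (α * m * n + n) with hc
  have hc1 : 1 ≤ c := le_max_left _ _
  set K : NNReal := (Real.sqrt (m + n) * c).toNNReal with hK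
  have hKr : (K : ℝ) = Real.sqrt (m + n) * c := Real.coe_toNNReal _ (by positivity)
  set d : ℝ := (m + n : ℝ) - 1 with hd
  have hd0 : 0 ≤ d := by
    have : (1 : ℝ) ≤ n := by exact_mod_cast hn
    have : (0 : ℝ) ≤ m := by positivity
    rw [hd]; linarith
  set P : Fin n × Bool → Set (EuclideanSpace ℝ (Fin m ⊕ Fin n)) := fun q =>
    {x | x ∈ S ∧ (∀ j, |x (Sum.inr j)| ≤ |x (Sum.inr q.1)|) ∧
      if q.2 then 0 ≤ x (Sum.inr q.1) else x (Sum.inr q.1) ≤ 0} with hP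
  have hcover : S ⊆ ⋃ q, P q := by
    intro x hx
    have : Nonempty (Fin n) := ⟨⟨0, hn⟩⟩
    obtain ⟨i, hi⟩ := Finite.exists_max fun j : Fin n => |x (Sum.inr j)|
    rw [Set.mem_iUnion]
    rcases le_total 0 (x (Sum.inr i)) with h | h
    · exact ⟨(i, true), hx, hi, by simpa using h⟩
    · exact ⟨(i, false), hx, hi, by simpa using h⟩
  have hpiece : ∀ q, ∀ x ∈ P q, ∀ x' ∈ P q, dist x x' ≤
      K * dist (fun j : {j // j ≠ Sum.inr q.1} => x j.1)
        (fun j : {j // j ≠ Sum.inr q.1} => x' j.1) := by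
    rintro ⟨i, σ⟩ x ⟨hxS, hxi, hxσ⟩ x' ⟨hxS', hxi', hxσ'⟩
    set D := dist (fun j : {j // j ≠ Sum.inr i} => x j.1)
        (fun j : {j // j ≠ Sum.inr i} => x' j.1) with hD
    have hD0 : 0 ≤ D := dist_nonneg
    have hj : ∀ j, j ≠ Sum.inr i → |x j - x' j| ≤ D := fun j hj =>
      dist_le_pi_dist (fun j : {j // j ≠ Sum.inr i} => x j.1)
        (fun j : {j // j ≠ Sum.inr i} => x' j.1) ⟨j, hj⟩
    have hsign : 0 ≤ x (Sum.inr i) * x' (Sum.inr i) := by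
      cases σ
      · exact mul_nonneg_of_nonpos_of_nonpos (by simpa using hxσ) (by simpa using hxσ')
      · exact mul_nonneg (by simpa using hxσ) (by simpa using hxσ')
    have hi := abs_sub_le_of_mem_cone_of_max_coord hα (hS x hxS) (hS x' hxS') hxi hxi' hsign
      hD0 hj
    have hall : ∀ j, |x j - x' j| ≤ c * D := by
      intro j
      rcases eq_or_ne j (Sum.inr i) with rfl | h
      · exact hi.trans (by gcongr; exact le_max_right _ _)
      · exact (hj j h).trans (le_mul_of_one_le_left hD0 hc1)
    rw [hKr, EuclideanSpace.dist_eq, mul_assoc]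
    refine Real.sqrt_le_iff.2 ⟨by positivity, ?_⟩
    rw [mul_pow, Real.sq_sqrt (by positivity)]
    calc _ ≤ ∑ _j : Fin m ⊕ Fin n, (c * D) ^ 2 := by
          refine Finset.sum_le_sum fun j _ => ?_
          rw [Real.dist_eq]
          gcongr
          exact hall j
      _ = _ := by simp
  refine ⟨Fintype.card (Fin n × Bool) * (K ^ d * (2 ^ d : ℝ).toNNReal), fun x r hr => ?_⟩
  calc _ ≤ Measure.hausdorffMeasure d (⋃ q, (P q ∩ Metric.closedBall x r)) := by
        rw [← Set.iUnion_inter]; gcongr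
    _ ≤ ∑ q, Measure.hausdorffMeasure d (P q ∩ Metric.closedBall x r) :=
        measure_iUnion_fintype_le _ _
    _ ≤ ∑ _q : Fin n × Bool,
          (K : ENNReal) ^ d * ENNReal.ofReal (2 ^ d) * ENNReal.ofReal (r ^ d) :=
        Finset.sum_le_sum fun q _ => hausdorffMeasure_inter_closedBall_le_of_coord_antilipschitz
          (Sum.inr q.1) (hpiece q) (by simp [hd]) x hr
    _ = _ := by
        rw [Finset.sum_const, nsmul_eq_mul, Finset.card_univ, ENNReal.coe_mul, ENNReal.coe_mul,
          ENNReal.coe_rpow_of_nonneg _ hd0, mul_assoc (_ : ENNReal) (_ * _) _]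
        rfl

theorem reflection_orthogonal_span_singleton_apply {ι : Type*} [Fintype ι]
    (u x : EuclideanSpace ℝ ι) {j : ι} (hj : u j = 0) : (ℝ ∙ u)ᗮ.reflection x j = x j := by
  rw [Submodule.reflection_orthogonal_apply, Submodule.reflection_singleton_apply]
  simp [hj]

theorem exists_linearIsometryEquiv_of_block_norm_eq {ι κ : Type*} [Fintype ι] [Fintype κ]
    {p q : EuclideanSpace ℝ (ι ⊕ κ)}
    (hl : ∑ i, p (Sum.inl i) ^ 2 = ∑ i, q (Sum.inl i) ^ 2)
    (hr : ∑ j, p (Sum.inr j) ^ 2 = ∑ j, q (Sum.inr j) ^ 2) :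
    ∃ R : EuclideanSpace ℝ (ι ⊕ κ) ≃ₗᵢ[ℝ] EuclideanSpace ℝ (ι ⊕ κ), R p = q ∧ ∀ x,
      ∑ i, R x (Sum.inl i) ^ 2 = ∑ i, x (Sum.inl i) ^ 2 ∧
      ∑ j, R x (Sum.inr j) ^ 2 = ∑ j, x (Sum.inr j) ^ 2 := by
  have hnorm : ∀ x : EuclideanSpace ℝ (ι ⊕ κ),
      ‖x‖ ^ 2 = ∑ i, x (Sum.inl i) ^ 2 + ∑ j, x (Sum.inr j) ^ 2 := fun x => by
    rw [EuclideanSpace.real_norm_sq_eq, Fintype.sum_sum_type]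
  set q' : EuclideanSpace ℝ (ι ⊕ κ) :=
    WithLp.toLp 2 (Sum.elim (fun i => q (Sum.inl i)) fun j => p (Sum.inr j)) with hq'
  set R₁ := (ℝ ∙ (p - q'))ᗮ.reflection
  set R₂ := (ℝ ∙ (q' - q))ᗮ.reflection
  have h1 : R₁ p = q' := Submodule.reflection_sub <| by
    rw [← sq_eq_sq₀ (norm_nonneg _) (norm_nonneg _), hnorm, hnorm]
    simp [hq', hl]
  have h2 : R₂ q' = q := Submodule.reflection_sub <| by
    rw [← sq_eq_sq₀ (norm_nonneg _) (norm_nonneg _), hnorm, hnorm]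
    simp [hq', hr]
  have hR₁ : ∀ x j, R₁ x (Sum.inr j) = x (Sum.inr j) := fun x j =>
    reflection_orthogonal_span_singleton_apply _ _ (by simp [hq'])
  have hR₂ : ∀ x i, R₂ x (Sum.inl i) = x (Sum.inl i) := fun x i =>
    reflection_orthogonal_span_singleton_apply _ _ (by simp [hq'])
  refine ⟨R₁.trans R₂, by simp [h1, h2], fun x => ?_⟩
  have e1 := hnorm x
  have e2 := hnorm (R₁ x)
  have e3 := hnorm (R₂ (R₁ x))
  simp only [LinearIsometryEquiv.norm_map, hR₁, hR₂] at e1 e2 e3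
  simp only [LinearIsometryEquiv.trans_apply, hR₂]
  constructor <;> linarith

open scoped Pointwise in
theorem integral_hausdorffMeasure_restrict_eq_of_similarity {E : Type*} [NormedAddCommGroup E]
    [NormedSpace ℝ E] [MeasurableSpace E] [BorelSpace E] {d : ℝ} (hd : 0 ≤ d) {S : Set E}
    (R : E ≃ₗᵢ[ℝ] E) {r : ℝ} (hr : 0 < r) (hS : ∀ x, r • R x ∈ S ↔ x ∈ S) (f : E → ℝ) :
    ∫ y, f y ∂((Measure.hausdorffMeasure d).restrict S)
      = r ^ d * ∫ y, f (r • R y) ∂((Measure.hausdorffMeasure d).restrict S) := by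
  set e : E ≃ᵐ E :=
    (R.toHomeomorph.trans (Homeomorph.smulOfNeZero r hr.ne')).toMeasurableEquiv with he
  have hea : ∀ y, e y = r • R y := fun y => rfl
  have hmap : (Measure.hausdorffMeasure d).restrict S
      = ENNReal.ofReal (r ^ d) • ((Measure.hausdorffMeasure d).restrict S).map e := by
    ext A hA
    rw [Measure.smul_apply, e.map_apply, Measure.restrict_apply hA,
      Measure.restrict_apply (e.measurable hA)]
    have h1 : A ∩ S = r • (R.toIsometryEquiv '' (e ⁻¹' A ∩ S)) := by
      rw [← Set.image_smul, Set.image_image]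
      ext y
      constructor
      · rintro ⟨hyA, hyS⟩
        obtain ⟨z, rfl⟩ := e.surjective y
        exact ⟨z, ⟨hyA, (hS z).1 hyS⟩, rfl⟩
      · rintro ⟨z, ⟨hzA, hzS⟩, rfl⟩
        exact ⟨hzA, (hS z).2 hzS⟩
    rw [h1, Measure.hausdorffMeasure_smul₀ hd hr.ne', IsometryEquiv.hausdorffMeasure_image]
    rw [ENNReal.smul_def, smul_eq_mul, smul_eq_mul]
    congr 1
    rw [← ENNReal.ofReal_coe_nnreal]
    congr 1
    simp [abs_of_pos hr]
  conv_lhs => rw [hmap]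
  rw [integral_smul_measure, integral_map_equiv, ENNReal.toReal_ofReal (by positivity)]
  simp only [hea, smul_eq_mul]

theorem truncated_integral_eq_of_cone {m n : ℕ} (hm : 1 ≤ m) {s α : ℝ}
    {S : Set (EuclideanSpace ℝ (Fin m ⊕ Fin n))}
    (hS : ∀ x, x ∈ S ↔ ∑ j, x (Sum.inr j) ^ 2 = α ^ 2 * ∑ k, x (Sum.inl k) ^ 2)
    {p x : EuclideanSpace ℝ (Fin m ⊕ Fin n)} (hp : p ∈ S) (hpn : ‖p‖ = 1) (hx : x ∈ S)
    (hx0 : x ≠ 0) {β : ℝ} {ε : ℝ} :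
    ∫ y in {y | ε ≤ dist x y}, (‖x‖ ^ (-β) - ‖y‖ ^ (-β)) / dist x y ^ ((m + n : ℝ) + s)
        ∂((Measure.hausdorffMeasure ((m + n : ℝ) - 1)).restrict S)
      = ‖x‖ ^ (-β) / ‖x‖ ^ (1 + s) * ∫ y in {y | ε / ‖x‖ ≤ dist p y},
        (1 - ‖y‖ ^ (-β)) / dist p y ^ ((m + n : ℝ) + s)
        ∂((Measure.hausdorffMeasure ((m + n : ℝ) - 1)).restrict S) := by
  have hr : 0 < ‖x‖ := norm_pos_iff.2 hx0
  have hnorm : ∀ x : EuclideanSpace ℝ (Fin m ⊕ Fin n),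
      ‖x‖ ^ 2 = ∑ i, x (Sum.inl i) ^ 2 + ∑ j, x (Sum.inr j) ^ 2 := fun x => by
    rw [EuclideanSpace.real_norm_sq_eq, Fintype.sum_sum_type]
  set q := ‖x‖⁻¹ • x with hq
  have hqn : ‖q‖ = 1 := by rw [hq, norm_smul, norm_inv, norm_norm, inv_mul_cancel₀ hr.ne']
  have hqS : q ∈ S := by
    rw [hS] at hx ⊢
    simp only [hq, PiLp.smul_apply, smul_eq_mul, mul_pow, ← Finset.mul_sum, hx]
    ring
  have hp1 := hnorm p
  have hq1 := hnorm q
  rw [hpn, (hS p).1 hp] at hp1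
  rw [hqn, (hS q).1 hqS] at hq1
  have hl : ∑ i, p (Sum.inl i) ^ 2 = ∑ i, q (Sum.inl i) ^ 2 := by
    have h1 : (1 + α ^ 2) * ∑ i, p (Sum.inl i) ^ 2 = (1 + α ^ 2) * ∑ i, q (Sum.inl i) ^ 2 := by
      linarith
    exact mul_left_cancel₀ (by positivity) h1
  obtain ⟨R, hRp, hR⟩ := exists_linearIsometryEquiv_of_block_norm_eq hl
    (by rw [(hS p).1 hp, (hS q).1 hqS, hl])
  have hRx : ‖x‖ • R p = x := by rw [hRp, hq, smul_inv_smul₀ hr.ne']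
  have hSR : ∀ y, ‖x‖ • R y ∈ S ↔ y ∈ S := by
    intro y
    rw [hS, hS]
    simp only [PiLp.smul_apply, smul_eq_mul, mul_pow, ← Finset.mul_sum, (hR y).1, (hR y).2]
    rw [mul_left_comm, mul_right_inj' (by positivity)]
  have hdist : ∀ y, dist x (‖x‖ • R y) = ‖x‖ * dist p y := by
    intro y
    calc dist x (‖x‖ • R y) = dist (‖x‖ • R p) (‖x‖ • R y) := by rw [hRx]
      _ = _ := by rw [dist_smul₀, norm_norm, R.dist_map]
  have hd : (0 : ℝ) ≤ (m + n : ℝ) - 1 := by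
    have : (1 : ℝ) ≤ m := by exact_mod_cast hm
    have : (0 : ℝ) ≤ n := by positivity
    linarith
  have m1 : MeasurableSet {y | ε ≤ dist x y} :=
    (isClosed_le continuous_const (by fun_prop)).measurableSet
  have m2 : MeasurableSet {y | ε / ‖x‖ ≤ dist p y} :=
    (isClosed_le continuous_const (by fun_prop)).measurableSet
  rw [← integral_indicator m1, ← integral_indicator m2,
    integral_hausdorffMeasure_restrict_eq_of_similarity hd R hr hSR, ← integral_const_mul,
    ← integral_const_mul]
  congr 1
  ext y
  simp only [Set.indicator, Set.mem_ofPred_eq, hdist, div_le_iff₀' hr]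
  split_ifs
  swap
  · simp
  rw [norm_smul, norm_norm, R.norm_map, Real.mul_rpow hr.le (norm_nonneg _),
    Real.mul_rpow hr.le dist_nonneg]
  have e : ‖x‖ ^ ((m + n : ℝ) + s) = ‖x‖ ^ ((m + n : ℝ) - 1) * ‖x‖ ^ (1 + s) := by
    rw [← Real.rpow_add hr]; congr 1; ring
  have e1 : ‖x‖ ^ ((m + n : ℝ) - 1) ≠ 0 := by positivity
  have e2 : ‖x‖ ^ (1 + s) ≠ 0 := by positivity
  rw [e]
  rcases eq_or_ne (dist p y ^ ((m + n : ℝ) + s)) 0 with h0 | h0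
  · simp [h0]
  · field_simp

/-- Fractional Hardy inequality on a Lawson cone `Σ = ∂E_α ⊆ ℝ^N`, `N = m + n`:
with `β = (N−2−s)/2` and
`H = p.v. ∫_Σ (1 − |y|^{−β})/|p̂−y|^{N+s} dy` (for `p̂ ∈ Σ`, `|p̂| = 1`),
every `φ ∈ C₀^∞(Σ∖{0})` satisfies
`H ∫_Σ φ²/|x|^{1+s} ≤ (1/2)∬_{Σ×Σ} (φ(x)−φ(y))²/|x−y|^{N+s}`,
where integration is with respect to the `(N−1)`-dimensional Hausdorff measure on `Σ`. -/
theorem fractional_hardy_on_cone (m n : ℕ) (hm : 1 ≤ m) (hn : 1 ≤ n)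
    (s : ℝ) (hs0 : 0 < s) (hs1 : s < 1) (α : ℝ) (hα : 0 < α)
    (S : Set (EuclideanSpace ℝ (Fin m ⊕ Fin n)))
    (hS : S = {x | Real.sqrt (∑ i : Fin n, x (Sum.inr i) ^ 2)
                = α * Real.sqrt (∑ i : Fin m, x (Sum.inl i) ^ 2)})
    (μ : Measure (EuclideanSpace ℝ (Fin m ⊕ Fin n)))
    (hμ : μ = (Measure.hausdorffMeasure ((m + n : ℝ) - 1)).restrict S)
    (p : EuclideanSpace ℝ (Fin m ⊕ Fin n)) (hp : p ∈ S) (hpn : ‖p‖ = 1)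
    (H : ℝ)
    (hH : Tendsto
      (fun δ : ℝ => ∫ y in {y | δ ≤ dist p y},
        (1 - ‖y‖ ^ (-(((m + n : ℝ) - 2 - s) / 2))) / dist p y ^ ((m + n : ℝ) + s) ∂μ)
      (𝓝[>] (0 : ℝ)) (𝓝 H))
    (φ : EuclideanSpace ℝ (Fin m ⊕ Fin n) → ℝ)
    (hφ : ContDiff ℝ (⊤ : ℕ∞) φ) (hφc : HasCompactSupport φ)
    (hφ0 : (0 : EuclideanSpace ℝ (Fin m ⊕ Fin n)) ∉ tsupport φ) :
    H * ∫ x, φ x ^ 2 / ‖x‖ ^ (1 + s) ∂μ ≤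
      1 / 2 * ∫ x, (∫ y, (φ x - φ y) ^ 2 / dist x y ^ ((m + n : ℝ) + s) ∂μ) ∂μ := by
  subst hμ
  have hm' : (1 : ℝ) ≤ m := by exact_mod_cast hm
  have hn' : (1 : ℝ) ≤ n := by exact_mod_cast hn
  have hSiff : ∀ x, x ∈ S ↔ ∑ j, x (Sum.inr j) ^ 2 = α ^ 2 * ∑ k, x (Sum.inl k) ^ 2 := by
    intro x
    have h1 : 0 ≤ ∑ j : Fin n, x (Sum.inr j) ^ 2 := by positivity
    have h2 : 0 ≤ ∑ k : Fin m, x (Sum.inl k) ^ 2 := by positivity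
    rw [hS, Set.mem_ofPred_eq, ← sq_eq_sq₀ (Real.sqrt_nonneg _) (by positivity), mul_pow,
      Real.sq_sqrt h1, Real.sq_sqrt h2]
  have hSm : MeasurableSet S := by
    rw [hS]
    exact (isClosed_eq (by fun_prop) (by fun_prop)).measurableSet
  obtain ⟨C, hC⟩ := hausdorffMeasure_cone_inter_closedBall_le hα hn fun x hx => (hSiff x).1 hx
  set μ := (Measure.hausdorffMeasure ((m + n : ℝ) - 1)).restrict S with hμ
  have hreg : ∀ x : EuclideanSpace ℝ (Fin m ⊕ Fin n), ∀ r : ℝ, 0 < r →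
      μ (Metric.closedBall x r) ≤ C * ENNReal.ofReal (r ^ ((m + n : ℝ) - 1)) := by
    intro x r hr
    rw [hμ, Measure.restrict_apply Metric.isClosed_closedBall.measurableSet, Set.inter_comm]
    exact hC x r hr
  have : IsLocallyFiniteMeasure μ := ⟨fun x => ⟨Metric.closedBall x 1,
    Metric.closedBall_mem_nhds x one_pos, (hreg x 1 one_pos).trans_lt
      (ENNReal.mul_lt_top ENNReal.coe_lt_top ENNReal.ofReal_lt_top)⟩⟩
  have hμ0 : μ {0} = 0 := by
    have := Measure.nullSingletonClass_hausdorff (EuclideanSpace ℝ (Fin m ⊕ Fin n))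
      (d := (m + n : ℝ) - 1) (by linarith)
    exact measure_singleton 0
  obtain ⟨L, hL⟩ := ContDiff.lipschitzWith_of_hasCompactSupport hφc hφ (by simp)
  obtain ⟨M, hM⟩ := hφc.exists_bound_of_continuous hφ.continuous
  obtain ⟨b, hb⟩ := hφc.isCompact.isBounded.exists_norm_le
  obtain ⟨a, ha, hab⟩ := Metric.mem_nhds_iff.1
    ((isClosed_tsupport φ).isOpen_compl.mem_nhds hφ0)
  refine fractional_hardy_of_truncated_identity (by linarith) hs0 hs1 hreg hμ0 hH ?_ hL hM ha
    (b := max b 1) (by positivity) fun x hx => ⟨?_, ?_⟩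
  · filter_upwards [ae_restrict_mem hSm] with x hx hx0 ε _
    exact truncated_integral_eq_of_cone hm hSiff hp hpn hx hx0
  · by_contra! h
    exact hab (by simpa using h) (subset_tsupport φ hx)
  · exact (hb x (subset_tsupport φ hx)).trans (le_max_left _ _)
end

section
/- Let E_{α} = {(y,z) ∈ ℝ^m × ℝ^n : |z| > α|y|}, and for 0 < α₂ < α₁ set β_i = arctan(α_i) and θ = β₁ − β₂ ∈ (0, π/2). Then for every t with 1 ≤ t ≤ 1/sin(β₁), one has arccos(sin(β₁)·t) + θ ≤ arccos(sin(β₂)·t), with equality at t = 1. -/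
/-- If `sin u * sin b = sin v * sin a` with `0 ≤ b`, `v ≤ u`, `v + a ≤ π` and `a + b ≤ u + v`,
then `v + a ≤ u + b`. -/
lemma add_le_add_of_sin_mul_sin_eq {a b u v : ℝ} (hb : 0 ≤ b) (hvu : v ≤ u)
    (hsum : a + b ≤ u + v) (hva : v + a ≤ Real.pi)
    (h : Real.sin u * Real.sin b = Real.sin v * Real.sin a) :
    v + a ≤ u + b := by
  by_contra! hlt
  have hcos : Real.cos (v + a) < Real.cos (u + b) :=
    Real.cos_lt_cos_of_nonneg_of_le_pi (by linarith) hva hlt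
  have hcos' : Real.cos (u - b) ≤ Real.cos (v - a) := by
    rw [← Real.cos_abs (v - a)]
    exact Real.cos_le_cos_of_nonneg_of_le_pi (abs_nonneg _) (by linarith)
      (abs_le.2 ⟨by linarith, by linarith⟩)
  rw [Real.cos_add, Real.cos_add] at hcos
  rw [Real.cos_sub, Real.cos_sub] at hcos'
  linarith

/-- The key trigonometric inequality for uniqueness of `s`-minimal Lawson cones:
with `β_i = arctan α_i` for `0 < α₂ < α₁` and `θ = β₁ − β₂ ∈ (0,π/2)`, for every
`1 ≤ t ≤ 1/sin β₁` one has `arccos(sin β₁ · t) + θ ≤ arccos(sin β₂ · t)`,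
with equality at `t = 1`. -/
theorem cone_rotation_trig_inequality (α₁ α₂ : ℝ) (h2 : 0 < α₂) (h12 : α₂ < α₁) :
    0 < Real.arctan α₁ - Real.arctan α₂ ∧
    Real.arctan α₁ - Real.arctan α₂ < Real.pi / 2 ∧
    (∀ t : ℝ, 1 ≤ t → t ≤ 1 / Real.sin (Real.arctan α₁) →
      Real.arccos (Real.sin (Real.arctan α₁) * t) + (Real.arctan α₁ - Real.arctan α₂)
        ≤ Real.arccos (Real.sin (Real.arctan α₂) * t)) ∧
    Real.arccos (Real.sin (Real.arctan α₁) * 1) + (Real.arctan α₁ - Real.arctan α₂)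
      = Real.arccos (Real.sin (Real.arctan α₂) * 1) := by
  have hb : 0 < Real.arctan α₂ := Real.arctan_pos.2 h2
  have hba : Real.arctan α₂ < Real.arctan α₁ := Real.arctan_strictMono h12
  have ha : Real.arctan α₁ < Real.pi / 2 := Real.arctan_lt_pi_div_two α₁
  generalize Real.arctan α₁ = a at *
  generalize Real.arctan α₂ = b at *
  have hsa : Real.arcsin (Real.sin a) = a := Real.arcsin_sin (by linarith) ha.le
  have hsb : Real.arcsin (Real.sin b) = b := Real.arcsin_sin (by linarith) (by linarith)
  refine ⟨by linarith, by linarith, fun t ht ht' => ?_, ?_⟩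
  · have hsb0 : 0 < Real.sin b := Real.sin_pos_of_pos_of_lt_pi hb (by linarith)
    have hsab : Real.sin b < Real.sin a :=
      Real.sin_lt_sin_of_lt_of_le_pi_div_two (by linarith) ha.le hba
    have hat : Real.sin a * t ≤ 1 := by
      rwa [le_div_iff₀ (hsb0.trans hsab), mul_comm] at ht'
    have hbat : Real.sin b * t ≤ Real.sin a * t := by gcongr
    have hbt : 0 ≤ Real.sin b * t := by positivity
    have hau : a ≤ Real.arcsin (Real.sin a * t) :=
      hsa.symm.le.trans (Real.monotone_arcsin (by nlinarith))
    have hbv : b ≤ Real.arcsin (Real.sin b * t) :=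
      hsb.symm.le.trans (Real.monotone_arcsin (by nlinarith))
    have hv := Real.arcsin_le_pi_div_two (Real.sin b * t)
    have key := add_le_add_of_sin_mul_sin_eq (a := a) hb.le (Real.monotone_arcsin hbat)
      (by linarith) (by linarith) (by
        rw [Real.sin_arcsin (by linarith) hat, Real.sin_arcsin (by linarith) (by linarith)]
        ring)
    rw [Real.arccos, Real.arccos]
    linarith
  · rw [mul_one, mul_one, Real.arccos, Real.arccos, hsa, hsb]
    ring
end
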